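/- Suppose the matrix A together with γ̄ satisfies Assumption 2, let X(t) be generated by the algorithm from X₀ ∈ S(n,d,γ̄), and let v(X₀) ∈ S^{n-1} be the strictly positive unit vector to which all Euclidean-normalized rows of Ã(k,t₀,X₀) converge. If the row vector u := v(X₀)X₀ ∈ ℝ^d is nonzero, then the states converge point-wise: for every i, x_i(t) converges as t → ∞ to P_{γ_i}(u) = γ_i(u/‖u‖₂)·u/‖u‖₂; equivalently, X(t) converges to the rank-one-direction matrix whose i-th row is P_{γ_i}(v(X₀)X₀). In particular, if γ_i = γ_j for all i, j, all agents' states converge to the same point. -/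

import Mathlib

open Finset Filter Topology Matrix

noncomputable def euclNorm {d : ℕ} (x : Fin d → ℝ) : ℝ := Real.sqrt (∑ j, x j ^ 2)

def unitSphere (d : ℕ) : Set (Fin d → ℝ) := {x | euclNorm x = 1}

/-- A directional function on `S^{d-1}`: continuous and bounded above and below
by positive constants on the unit sphere. -/
def IsDirectional {d : ℕ} (γ : (Fin d → ℝ) → ℝ) : Prop :=
  ContinuousOn γ (unitSphere d) ∧
    ∃ c C : ℝ, 0 < c ∧ ∀ x ∈ unitSphere d, c ≤ γ x ∧ γ x ≤ C

/-- The star boundary `S^{d-1}_γ = {γ(x) x : x ∈ S^{d-1}}`. -/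
def starBoundary {d : ℕ} (γ : (Fin d → ℝ) → ℝ) : Set (Fin d → ℝ) :=
  {y | ∃ x ∈ unitSphere d, y = γ x • x}

/-- `S(n,d,γ̄)`: matrices whose `i`-th row lies on the star boundary of `γ_i`. -/
def Sset (n d : ℕ) (γbar : Fin n → (Fin d → ℝ) → ℝ) : Set (Matrix (Fin n) (Fin d) ℝ) :=
  {X | ∀ i, X i ∈ starBoundary (γbar i)}

/-- Radial projection `P_γ(y) = γ(y/‖y‖₂) · y/‖y‖₂`. -/
noncomputable def radialProj {d : ℕ} (γ : (Fin d → ℝ) → ℝ) (y : Fin d → ℝ) : Fin d → ℝ :=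
  γ ((euclNorm y)⁻¹ • y) • ((euclNorm y)⁻¹ • y)

/-- Row-wise radial projection. -/
noncomputable def rowProj {n d : ℕ} (γbar : Fin n → (Fin d → ℝ) → ℝ)
    (B : Matrix (Fin n) (Fin d) ℝ) : Matrix (Fin n) (Fin d) ℝ :=
  Matrix.of fun i => radialProj (γbar i) (B i)

/-- Assumption 2: each `γ_i` is directional, `A` is a nonnegative weight matrix of a strongly
connected digraph, and the diagonal-dominance condition
`a_ii · min γ_i > Σ_{j≠i} a_ij · max γ_j` holds. -/
def Assumption2 {n d : ℕ} (A : Matrix (Fin n) (Fin n) ℝ)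
    (γbar : Fin n → (Fin d → ℝ) → ℝ) : Prop :=
  (∀ i, IsDirectional (γbar i)) ∧
  (∃ E : Fin n → Fin n → Prop,
    (∀ i j, E i j → 0 < A i j) ∧ (∀ i j, ¬ E i j → A i j = 0) ∧
    (∀ i j, Relation.ReflTransGen E i j)) ∧
  (∀ i, (∑ j ∈ Finset.univ.erase i, A i j * sSup (γbar j '' unitSphere d)) <
      A i i * sInf (γbar i '' unitSphere d))

/-- The trajectory of the algorithm `X(t+1) = P_γ̄(A X(t))`, indexed by `k = t - t₀`. -/
noncomputable def traj {n d : ℕ} (A : Matrix (Fin n) (Fin n) ℝ)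
    (γbar : Fin n → (Fin d → ℝ) → ℝ) (X₀ : Matrix (Fin n) (Fin d) ℝ) :
    ℕ → Matrix (Fin n) (Fin d) ℝ
  | 0 => X₀
  | k + 1 => rowProj γbar (A * traj A γbar X₀ k)

/-- `D_γ̄(B)`: diagonal matrix with entries `γ_i([B]_i/‖[B]_i‖₂)/‖[B]_i‖₂`. -/
noncomputable def Dmat {n d : ℕ} (γbar : Fin n → (Fin d → ℝ) → ℝ)
    (B : Matrix (Fin n) (Fin d) ℝ) : Matrix (Fin n) (Fin n) ℝ :=
  Matrix.diagonal fun i => γbar i ((euclNorm (B i))⁻¹ • B i) / euclNorm (B i)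

/-- The product matrices `Ã(k,t₀,X₀) = D_γ̄(A X(t₀+k−1))A ⋯ D_γ̄(A X(t₀))A`. -/
noncomputable def Atilde {n d : ℕ} (A : Matrix (Fin n) (Fin n) ℝ)
    (γbar : Fin n → (Fin d → ℝ) → ℝ) (X₀ : Matrix (Fin n) (Fin d) ℝ) :
    ℕ → Matrix (Fin n) (Fin n) ℝ
  | 0 => 1
  | k + 1 => Dmat γbar (A * traj A γbar X₀ k) * A * Atilde A γbar X₀ k

/-- `v` is the strictly positive unit vector to which all Euclidean-normalized rows of
`Ã(k,t₀,X₀)` converge. -/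
def IsLimitVec {n d : ℕ} (A : Matrix (Fin n) (Fin n) ℝ)
    (γbar : Fin n → (Fin d → ℝ) → ℝ) (X₀ : Matrix (Fin n) (Fin d) ℝ)
    (v : Fin n → ℝ) : Prop :=
  euclNorm v = 1 ∧ (∀ i, 0 < v i) ∧
    ∀ i, Tendsto (fun k => (euclNorm (Atilde A γbar X₀ k i))⁻¹ • Atilde A γbar X₀ k i)
      atTop (𝓝 v)

/-- Asymptotic consensus of directions. -/
def ConsensusDir {n d : ℕ} (X : ℕ → Matrix (Fin n) (Fin d) ℝ) : Prop :=
  ∀ i j, Tendsto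
    (fun t => euclNorm ((euclNorm (X t i))⁻¹ • X t i - (euclNorm (X t j))⁻¹ • X t j))
    atTop (𝓝 0)

/-- Asymptotic consensus of directions with point-wise convergence to a unit vector. -/
def ConsensusPW {n d : ℕ} (X : ℕ → Matrix (Fin n) (Fin d) ℝ) : Prop :=
  ∃ u : Fin d → ℝ, euclNorm u = 1 ∧
    ∀ i, Tendsto (fun t => (euclNorm (X t i))⁻¹ • X t i) atTop (𝓝 u)

lemma euclNorm_smul_of_nonneg {d : ℕ} {c : ℝ} (hc : 0 ≤ c) (x : Fin d → ℝ) :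
    euclNorm (c • x) = c * euclNorm x := by
  simp only [euclNorm, Pi.smul_apply, smul_eq_mul, mul_pow, ← Finset.mul_sum]
  rw [Real.sqrt_mul (sq_nonneg c), Real.sqrt_sq hc]

lemma euclNorm_pos {d : ℕ} {x : Fin d → ℝ} (hx : x ≠ 0) : 0 < euclNorm x := by
  obtain ⟨j, hj⟩ := Function.ne_iff.mp hx
  exact Real.sqrt_pos.mpr
    (Finset.sum_pos' (fun i _ => sq_nonneg (x i)) ⟨j, Finset.mem_univ j, sq_pos_of_ne_zero hj⟩)

lemma continuous_euclNorm {d : ℕ} : Continuous (euclNorm (d := d)) := by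
  unfold euclNorm
  fun_prop

lemma normalize_mem_unitSphere {d : ℕ} {x : Fin d → ℝ} (hx : x ≠ 0) :
    (euclNorm x)⁻¹ • x ∈ unitSphere d := by
  have h := euclNorm_pos hx
  change euclNorm _ = 1
  rw [euclNorm_smul_of_nonneg (inv_nonneg.mpr h.le), inv_mul_cancel₀ h.ne']

lemma IsDirectional.pos {d : ℕ} {γ : (Fin d → ℝ) → ℝ} (hγ : IsDirectional γ)
    {x : Fin d → ℝ} (hx : x ∈ unitSphere d) : 0 < γ x := by
  obtain ⟨c, C, hc, h⟩ := hγ.2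
  exact hc.trans_le (h x hx).1

lemma radialProj_smul_of_pos {d : ℕ} (γ : (Fin d → ℝ) → ℝ) {c : ℝ} (hc : 0 < c)
    (x : Fin d → ℝ) : radialProj γ (c • x) = radialProj γ x := by
  have h : (euclNorm (c • x))⁻¹ • c • x = (euclNorm x)⁻¹ • x := by
    rw [euclNorm_smul_of_nonneg hc.le, smul_smul, mul_inv, mul_right_comm,
      inv_mul_cancel₀ hc.ne', one_mul]
  simp only [radialProj, h]

lemma radialProj_radialProj {d : ℕ} {γ : (Fin d → ℝ) → ℝ} (hγ : IsDirectional γ)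
    (x : Fin d → ℝ) : radialProj γ (radialProj γ x) = radialProj γ x := by
  rcases eq_or_ne x 0 with rfl | hx
  · simp [radialProj]
  · have hpos := hγ.pos (normalize_mem_unitSphere hx)
    conv_lhs => rw [radialProj.eq_def γ x]
    rw [radialProj_smul_of_pos γ hpos, radialProj_smul_of_pos γ (inv_pos.mpr (euclNorm_pos hx))]

lemma continuousAt_radialProj {d : ℕ} {γ : (Fin d → ℝ) → ℝ} (hγ : IsDirectional γ)
    {x : Fin d → ℝ} (hx : x ≠ 0) : ContinuousAt (radialProj γ) x := by
  have hnorm : ContinuousAt (fun y : Fin d → ℝ => (euclNorm y)⁻¹ • y) x :=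
    (continuous_euclNorm.continuousAt.inv₀ (euclNorm_pos hx).ne').smul continuousAt_id
  have hmem : ∀ᶠ y in 𝓝 x, (euclNorm y)⁻¹ • y ∈ unitSphere d :=
    (eventually_ne_nhds hx).mono fun y hy => normalize_mem_unitSphere hy
  have hγx : Tendsto (fun y => γ ((euclNorm y)⁻¹ • y)) (𝓝 x) (𝓝 (γ ((euclNorm x)⁻¹ • x))) :=
    (hγ.1 _ (normalize_mem_unitSphere hx)).tendsto.comp
      (tendsto_nhdsWithin_iff.mpr ⟨hnorm, hmem⟩)
  exact hγx.smul hnorm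

lemma rowProj_eq_Dmat_mul {n d : ℕ} (γbar : Fin n → (Fin d → ℝ) → ℝ)
    (B : Matrix (Fin n) (Fin d) ℝ) : rowProj γbar B = Dmat γbar B * B := by
  ext i j
  simp only [rowProj, radialProj, Dmat, Matrix.of_apply, Matrix.diagonal_mul, Pi.smul_apply,
    smul_eq_mul]
  ring

lemma traj_eq_Atilde_mul {n d : ℕ} (A : Matrix (Fin n) (Fin n) ℝ)
    (γbar : Fin n → (Fin d → ℝ) → ℝ) (X₀ : Matrix (Fin n) (Fin d) ℝ) (k : ℕ) :
    traj A γbar X₀ k = Atilde A γbar X₀ k * X₀ := by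
  induction k with
  | zero => simp [traj, Atilde]
  | succ k ih =>
    rw [traj, rowProj_eq_Dmat_mul, Atilde, Matrix.mul_assoc, Matrix.mul_assoc, ← ih]

lemma radialProj_traj_succ {n d : ℕ} (A : Matrix (Fin n) (Fin n) ℝ)
    {γbar : Fin n → (Fin d → ℝ) → ℝ} (X₀ : Matrix (Fin n) (Fin d) ℝ) {i : Fin n}
    (hγ : IsDirectional (γbar i)) (k : ℕ) :
    radialProj (γbar i) (traj A γbar X₀ (k + 1) i) = traj A γbar X₀ (k + 1) i :=
  radialProj_radialProj hγ _

theorem stmt13 {n d : ℕ} (hn : 1 ≤ n) (hd : 1 ≤ d)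
    (A : Matrix (Fin n) (Fin n) ℝ) (γbar : Fin n → (Fin d → ℝ) → ℝ)
    (hA : Assumption2 A γbar)
    (X₀ : Matrix (Fin n) (Fin d) ℝ) (hX₀ : X₀ ∈ Sset n d γbar)
    (v : Fin n → ℝ) (hv : IsLimitVec A γbar X₀ v)
    (hne : Matrix.vecMul v X₀ ≠ (0 : Fin d → ℝ)) :
    (∀ i, Tendsto (fun t => traj A γbar X₀ t i) atTop
      (𝓝 (radialProj (γbar i) (Matrix.vecMul v X₀)))) ∧
    ((∀ i j : Fin n, γbar i = γbar j) → ∀ i j : Fin n,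
      radialProj (γbar i) (Matrix.vecMul v X₀) =
        radialProj (γbar j) (Matrix.vecMul v X₀)) := by
  refine ⟨fun i => ?_, fun h i j => by rw [h i j]⟩
  have hγ := hA.1 i
  obtain ⟨-, hvpos, hlim⟩ := hv
  have hv0 : v ≠ 0 := fun h => (hvpos i).ne' (congrFun h i)
  have hdir : Tendsto (fun k => radialProj (γbar i)
      (((euclNorm (Atilde A γbar X₀ k i))⁻¹ • Atilde A γbar X₀ k i) ᵥ* X₀)) atTop
      (𝓝 (radialProj (γbar i) (v ᵥ* X₀))) := by
    have hmul : Continuous fun w : Fin n → ℝ => w ᵥ* X₀ := by fun_prop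
    exact (continuousAt_radialProj hγ hne).tendsto.comp ((hmul.tendsto v).comp (hlim i))
  refine hdir.congr' ?_
  filter_upwards [(hlim i).eventually_ne hv0, eventually_ge_atTop 1] with k hk hk1
  have hrow : Atilde A γbar X₀ k i ≠ 0 := fun h => hk (by rw [h, smul_zero])
  obtain ⟨m, rfl⟩ := Nat.exists_eq_add_of_le' hk1
  rw [Matrix.smul_vecMul, radialProj_smul_of_pos _ (inv_pos.mpr (euclNorm_pos hrow)),
    ← radialProj_traj_succ A X₀ hγ m, traj_eq_Atilde_mul, Matrix.mul_apply_eq_vecMul]
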